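/- Let D ∈ ℝ^{p×m} and y ∈ ℝ^p. If ŵ ∈ ℝ^p is the global minimizer over ℝ^p of the primal denoising objective F(w) = ½‖y − w‖₂² + ‖Dᵀw‖₁, then there exists ẑ ∈ B∞ such that ŵ = y − Dẑ and ẑ minimizes the dual objective G(z) = ½‖Dz − y‖₂² over B∞. -/

import Mathlib

/-- The closed unit ball of the ℓ∞ norm on ℝ^m. -/
def Binf (m : ℕ) : Set (Fin m → ℝ) := {z | ∀ i, |z i| ≤ 1}

/-- The primal denoising objective `F(w) = ½‖y − w‖₂² + ‖Dᵀw‖₁`. -/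
noncomputable def primalObj {p m : ℕ} (D : Matrix (Fin p) (Fin m) ℝ)
    (y w : Fin p → ℝ) : ℝ :=
  (1 / 2) * ∑ i, (y i - w i) ^ 2 + ∑ j, |D.transpose.mulVec w j|

/-- The dual objective `G(z) = ½‖Dz − y‖₂²`. -/
noncomputable def dualObj {p m : ℕ} (D : Matrix (Fin p) (Fin m) ℝ)
    (y : Fin p → ℝ) (z : Fin m → ℝ) : ℝ :=
  (1 / 2) * ∑ i, (D.mulVec z i - y i) ^ 2

theorem Binf_eq_Icc (m : ℕ) : Binf m = Set.Icc (-1) 1 := by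
  ext z
  simp [Binf, abs_le, Pi.le_def, forall_and]

theorem isCompact_Binf (m : ℕ) : IsCompact (Binf m) := by
  rw [Binf_eq_Icc]
  exact isCompact_Icc

theorem convex_Binf (m : ℕ) : Convex ℝ (Binf m) := by
  rw [Binf_eq_Icc]
  exact convex_Icc _ _

theorem dualObj_eq_dotProduct {p m : ℕ} (D : Matrix (Fin p) (Fin m) ℝ)
    (y : Fin p → ℝ) (z : Fin m → ℝ) :
    dualObj D y z = (1 / 2) * ((D.mulVec z - y) ⬝ᵥ (D.mulVec z - y)) := by
  simp [dualObj, dotProduct, pow_two]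

theorem continuous_dualObj {p m : ℕ} (D : Matrix (Fin p) (Fin m) ℝ) (y : Fin p → ℝ) :
    Continuous (dualObj D y) := by
  unfold dualObj Matrix.mulVec dotProduct
  fun_prop

/-- The pairing of a vector with an element of the `ℓ∞` ball is at most its `ℓ1` norm. -/
theorem dotProduct_le_sum_abs {m : ℕ} (v : Fin m → ℝ) {z : Fin m → ℝ} (hz : z ∈ Binf m) :
    v ⬝ᵥ z ≤ ∑ j, |v j| := by
  refine Finset.sum_le_sum fun j _ => (le_abs_self _).trans ?_
  rw [abs_mul]
  exact mul_le_of_le_one_right (abs_nonneg _) (hz j)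

/-- The `ℓ1` norm is attained as a pairing with an element of the `ℓ∞` ball. -/
theorem exists_mem_Binf_dotProduct_eq {m : ℕ} (v : Fin m → ℝ) :
    ∃ z ∈ Binf m, v ⬝ᵥ z = ∑ j, |v j| := by
  refine ⟨fun j => if 0 ≤ v j then 1 else -1, fun j => ?_, Finset.sum_congr rfl fun j _ => ?_⟩
  · dsimp only
    split_ifs <;> simp
  · dsimp only
    split_ifs with h
    · rw [abs_of_nonneg h, mul_one]
    · rw [abs_of_neg (not_le.mp h), mul_neg_one]

/-- First-order optimality condition for a minimizer of the dual objective. -/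
theorem dotProduct_mulVec_le_of_dual_minimizer {p m : ℕ} (D : Matrix (Fin p) (Fin m) ℝ)
    (y : Fin p → ℝ) {z₀ z : Fin m → ℝ} (hz₀ : z₀ ∈ Binf m) (hz : z ∈ Binf m)
    (hmin : ∀ z ∈ Binf m, dualObj D y z₀ ≤ dualObj D y z) :
    (y - D.mulVec z₀) ⬝ᵥ D.mulVec z ≤ (y - D.mulVec z₀) ⬝ᵥ D.mulVec z₀ := by
  set a := D.mulVec z₀ - y with ha
  set b := D.mulVec z - D.mulVec z₀ with hb
  have hB : 0 ≤ b ⬝ᵥ b := Finset.sum_nonneg fun i _ => mul_self_nonneg (b i)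
  have key : ∀ t : ℝ, 0 ≤ t → t ≤ 1 → 0 ≤ t * (2 * (a ⬝ᵥ b) + t * (b ⬝ᵥ b)) := by
    intro t h0 h1
    have hle := hmin _ ((convex_Binf m).add_smul_sub_mem hz₀ hz ⟨h0, h1⟩)
    have hab : D.mulVec (z₀ + t • (z - z₀)) - y = a + t • b := by
      rw [Matrix.mulVec_add, Matrix.mulVec_smul, Matrix.mulVec_sub, ha, hb]
      abel
    rw [dualObj_eq_dotProduct, dualObj_eq_dotProduct, hab, ← ha] at hle
    simp only [add_dotProduct, dotProduct_add, smul_dotProduct, dotProduct_smul, smul_eq_mul,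
      dotProduct_comm b a] at hle
    linarith
  have hnonneg : 0 ≤ a ⬝ᵥ b := by
    by_contra! hc
    have hden : 0 < b ⬝ᵥ b - a ⬝ᵥ b := by linarith
    have ht : 0 < -(a ⬝ᵥ b) / (b ⬝ᵥ b - a ⬝ᵥ b) := div_pos (by linarith) hden
    have ht1 : -(a ⬝ᵥ b) / (b ⬝ᵥ b - a ⬝ᵥ b) ≤ 1 := (div_le_one hden).2 (by linarith)
    have h := nonneg_of_mul_nonneg_right (key _ ht.le ht1) ht
    have htB : -(a ⬝ᵥ b) / (b ⬝ᵥ b - a ⬝ᵥ b) * (b ⬝ᵥ b) ≤ -(a ⬝ᵥ b) := by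
      rw [div_mul_eq_mul_div, div_le_iff₀ hden]
      nlinarith
    linarith
  rw [← neg_sub (D.mulVec z₀) y, ← ha, neg_dotProduct, neg_dotProduct, neg_le_neg_iff,
    ← sub_nonneg, ← dotProduct_sub]
  exact hnonneg

/-- If `z₀` minimizes the dual objective, the primal objective grows quadratically
around `y - D z₀`. -/
theorem primalObj_add_le_of_dual_minimizer {p m : ℕ} (D : Matrix (Fin p) (Fin m) ℝ)
    (y : Fin p → ℝ) {z₀ : Fin m → ℝ} (hz₀ : z₀ ∈ Binf m)
    (hmin : ∀ z ∈ Binf m, dualObj D y z₀ ≤ dualObj D y z) (w : Fin p → ℝ) :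
    primalObj D y (y - D.mulVec z₀) +
      (1 / 2) * ((w - (y - D.mulVec z₀)) ⬝ᵥ (w - (y - D.mulVec z₀))) ≤ primalObj D y w := by
  have hadj : ∀ x z, D.transpose.mulVec x ⬝ᵥ z = x ⬝ᵥ D.mulVec z := fun x z => by
    rw [Matrix.mulVec_transpose, Matrix.dotProduct_mulVec]
  have hobj : ∀ x, primalObj D y x =
      (1 / 2) * ((y - x) ⬝ᵥ (y - x)) + ∑ j, |D.transpose.mulVec x j| := fun x => by
    simp [primalObj, dotProduct, pow_two]
  obtain ⟨z, hz, hzeq⟩ := exists_mem_Binf_dotProduct_eq (D.transpose.mulVec (y - D.mulVec z₀))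
  have h₁ := dotProduct_mulVec_le_of_dual_minimizer D y hz₀ hz hmin
  have h₂ := dotProduct_le_sum_abs (D.transpose.mulVec w) hz₀
  rw [hadj] at hzeq h₂
  rw [hobj, hobj, ← hzeq]
  generalize D.mulVec z₀ = u at *
  simp only [sub_dotProduct, dotProduct_sub, dotProduct_comm u y, dotProduct_comm w y,
    dotProduct_comm w u] at *
  linarith

/-- If `ŵ` is the global minimizer over `ℝ^p` of the primal denoising objective
`F(w) = ½‖y − w‖₂² + ‖Dᵀw‖₁`, then there exists `ẑ ∈ B∞` with `ŵ = y − Dẑ` that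
minimizes the dual objective `G(z) = ½‖Dz − y‖₂²` over `B∞`. -/
theorem primal_to_dual_minimizer (p m : ℕ)
    (D : Matrix (Fin p) (Fin m) ℝ) (y : Fin p → ℝ)
    (wopt : Fin p → ℝ)
    (hmin : ∀ w : Fin p → ℝ, primalObj D y wopt ≤ primalObj D y w) :
    ∃ zopt ∈ Binf m, wopt = y - D.mulVec zopt ∧
      ∀ z ∈ Binf m, dualObj D y zopt ≤ dualObj D y z := by
  obtain ⟨z₀, hz₀, hz₀min⟩ := (isCompact_Binf m).exists_isMinOn
    ⟨0, fun i => by simp⟩ (continuous_dualObj D y).continuousOn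
  refine ⟨z₀, hz₀, ?_, fun z hz => hz₀min hz⟩
  have h := primalObj_add_le_of_dual_minimizer D y hz₀ (fun z hz => hz₀min hz) wopt
  have hle := hmin (y - D.mulVec z₀)
  have hnonneg : 0 ≤ (wopt - (y - D.mulVec z₀)) ⬝ᵥ (wopt - (y - D.mulVec z₀)) :=
    Finset.sum_nonneg fun i _ => mul_self_nonneg _
  exact sub_eq_zero.mp (dotProduct_self_eq_zero.mp (by linarith))
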